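/- arXiv:1205.0380 — 4 statements merged into one kernel-verified Lean document; each statement's English description precedes it below -/
import Mathlib

section
/- Let n ≥ 1 be an integer, τ > 0 and x₀ ∈ ℝⁿ, and let ν = ν_{x₀,τ}. Then for all nonempty Borel sets A, B ⊆ ℝⁿ, the Gaussian concentration inequality ν(A)·ν(B) ≤ exp( - dist(A,B)²/(8τ) ) holds, where dist(A,B) = inf{ ‖a - b‖ : a ∈ A, b ∈ B } is the set distance. (This is the paper's Theorem 1.7 for the conjugate heat kernel measure of the static flat Ricci flow on ℝⁿ, with |s| = τ.) -/
open MeasureTheory Real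

/-- The conjugate heat kernel measure `ν_{x₀,τ}` of the static flat Ricci flow on `ℝⁿ`. -/
noncomputable def heatGaussian (n : ℕ) (τ : ℝ) (x₀ : EuclideanSpace ℝ (Fin n)) :
    Measure (EuclideanSpace ℝ (Fin n)) :=
  volume.withDensity fun y =>
    ENNReal.ofReal ((4 * π * τ) ^ (-(n : ℝ) / 2) * Real.exp (-‖y - x₀‖ ^ 2 / (4 * τ)))

/-- The set distance `dist(A,B) = inf { dist a b : a ∈ A, b ∈ B }`
(not the Hausdorff distance). -/
noncomputable def setDist {X : Type*} [MetricSpace X] (A B : Set X) : ℝ :=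
  sInf {d : ℝ | ∃ a ∈ A, ∃ b ∈ B, d = dist a b}

open scoped Pointwise in
/-- The one-dimensional Brunn–Minkowski inequality for compact sets. -/
theorem volume_add_volume_le_of_isCompact {K L : Set ℝ} (hK : IsCompact K) (hL : IsCompact L)
    (hKne : K.Nonempty) (hLne : L.Nonempty) :
    volume K + volume L ≤ volume (K + L) := by
  have hx := hK.sSup_mem hKne
  have hy := hL.sInf_mem hLne
  set x := sSup K
  set y := sInf L
  have hKx : ∀ k ∈ K, k ≤ x := fun k hk => le_csSup hK.bddAbove hk
  have hLy : ∀ l ∈ L, y ≤ l := fun l hl => csInf_le hL.bddBelow hl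
  have h1 : volume ((fun z => y + z) '' K) = volume K := by
    simp [Set.image_add_left, measure_preimage_add]
  have h2 : volume ((fun z => x + z) '' L) = volume L := by
    simp [Set.image_add_left, measure_preimage_add]
  have hdisj : AEDisjoint volume ((fun z => y + z) '' K) ((fun z => x + z) '' L) := by
    refine measure_mono_null (t := {x + y}) ?_ (by simp)
    rintro _ ⟨⟨k, hk, rfl⟩, ⟨l, hl, h⟩⟩
    have := hKx k hk
    have := hLy l hl
    simp only [Set.mem_singleton_iff] at h ⊢
    linarith
  rw [← h1, ← h2, ← measure_union₀ (hL.image (by fun_prop)).measurableSet.nullMeasurableSet hdisj]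
  apply measure_mono
  rintro _ (⟨k, hk, rfl⟩ | ⟨l, hl, rfl⟩)
  · simpa only [add_comm] using Set.add_mem_add hk hy
  · exact Set.add_mem_add hx hl

open scoped Pointwise in
theorem volume_add_volume_le {A B C : Set ℝ} (hA : MeasurableSet A) (hB : MeasurableSet B)
    (hAne : A.Nonempty) (hBne : B.Nonempty)
    (h : ∀ x ∈ A, ∀ y ∈ B, (2⁻¹ : ℝ) • (x + y) ∈ C) :
    volume A + volume B ≤ 2 * volume C := by
  obtain ⟨a, ha⟩ := hAne
  obtain ⟨b, hb⟩ := hBne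
  have key : ∀ K ⊆ A, IsCompact K → ∀ L ⊆ B, IsCompact L →
      volume K + volume L ≤ 2 * volume C := by
    intro K hKA hK L hLB hL
    calc volume K + volume L ≤ volume (insert a K) + volume (insert b L) := by
          gcongr <;> exact Set.subset_insert _ _
      _ ≤ volume (insert a K + insert b L) :=
          volume_add_volume_le_of_isCompact (hK.insert a) (hL.insert b)
            (Set.insert_nonempty _ _) (Set.insert_nonempty _ _)
      _ ≤ volume ((2 : ℝ) • C) := by
          apply measure_mono
          rintro _ ⟨k, hk, l, hl, rfl⟩
          rw [Set.mem_smul_set_iff_inv_smul_mem₀ two_ne_zero]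
          exact h k (Set.insert_subset ha hKA hk) l (Set.insert_subset hb hLB hl)
      _ = 2 * volume C := by simp [Measure.addHaar_smul]
  rw [hA.measure_eq_iSup_isCompact, hB.measure_eq_iSup_isCompact]
  simp only [iSup_and']
  refine ENNReal.biSup_add_biSup_le' (p := fun K => K ⊆ A ∧ IsCompact K)
    (q := fun K => K ⊆ B ∧ IsCompact K)
    ⟨∅, by simp⟩ ⟨∅, by simp⟩ ?_
  rintro K ⟨hKA, hK⟩ L ⟨hLB, hL⟩
  exact key K hKA hK L hLB hL

theorem four_mul_mul_le_add_sq (a b : ENNReal) : 4 * (a * b) ≤ (a + b) ^ 2 := by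
  rcases eq_or_ne a ⊤ with rfl | ha
  · simp
  rcases eq_or_ne b ⊤ with rfl | hb
  · simp
  lift a to NNReal using ha
  lift b to NNReal using hb
  norm_cast
  rw [← mul_assoc]
  exact four_mul_le_sq_add a b

theorem lintegral_eq_lintegral_meas_ofReal_lt {α : Type*} [MeasurableSpace α] (μ : Measure α)
    {f : α → ENNReal} (hf : Measurable f) (hfin : ∀ x, f x ≠ ⊤) :
    ∫⁻ x, f x ∂μ = ∫⁻ t in Set.Ioi (0 : ℝ), μ {x | ENNReal.ofReal t < f x} := by
  have h := lintegral_eq_lintegral_meas_lt (f := fun x => (f x).toReal) μ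
    (Filter.Eventually.of_forall fun x => ENNReal.toReal_nonneg) hf.ennreal_toReal.aemeasurable
  simp only [ENNReal.ofReal_toReal (hfin _)] at h
  rw [h]
  refine setLIntegral_congr_fun measurableSet_Ioi fun t ht => ?_
  congr 1
  ext x
  exact (ENNReal.ofReal_lt_iff_lt_toReal (le_of_lt ht) (hfin x)).symm

theorem lintegral_add_lintegral_le_of_iSup_eq_one {u v w : ℝ → ENNReal}
    (hu : Measurable u) (hv : Measurable v) (hw : Measurable w)
    (hu1 : ⨆ x, u x = 1) (hv1 : ⨆ x, v x = 1)
    (h : ∀ x y, min (u x) (v y) ≤ w ((2⁻¹ : ℝ) • (x + y))) :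
    (∫⁻ x, u x) + ∫⁻ x, v x ≤ 2 * ∫⁻ x, w x := by
  have hule : ∀ x, u x ≤ 1 := fun x => hu1 ▸ le_iSup u x
  have hvle : ∀ x, v x ≤ 1 := fun x => hv1 ▸ le_iSup v x
  have hwm : ∫⁻ x, min (w x) 1 ≤ ∫⁻ x, w x := lintegral_mono fun x => min_le_left _ _
  refine le_trans ?_ (mul_le_mul_right hwm 2)
  rw [lintegral_eq_lintegral_meas_ofReal_lt volume hu fun x => ((hule x).trans_lt (by simp)).ne,
    lintegral_eq_lintegral_meas_ofReal_lt volume hv fun x => ((hvle x).trans_lt (by simp)).ne,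
    lintegral_eq_lintegral_meas_ofReal_lt volume (hw.min measurable_const)
      fun x => ((min_le_right _ _).trans_lt (by simp)).ne]
  have hanti : Antitone fun t : ℝ => volume {x | ENNReal.ofReal t < u x} := fun s t hst =>
    measure_mono fun x hx => (ENNReal.ofReal_le_ofReal hst).trans_lt hx
  rw [← lintegral_add_left hanti.measurable, ← lintegral_const_mul' _ _ (by simp)]
  refine lintegral_mono fun t => ?_
  rcases lt_or_ge (ENNReal.ofReal t) 1 with ht | ht
  · have hune : {x | ENNReal.ofReal t < u x}.Nonempty := lt_iSup_iff.1 (ht.trans_eq hu1.symm)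
    have hvne : {x | ENNReal.ofReal t < v x}.Nonempty := lt_iSup_iff.1 (ht.trans_eq hv1.symm)
    refine volume_add_volume_le (measurableSet_lt measurable_const hu)
      (measurableSet_lt measurable_const hv) hune hvne ?_
    intro x hx y hy
    exact lt_min ((lt_min hx hy).trans_le (h x y)) ht
  · have h1 : {x | ENNReal.ofReal t < u x} = ∅ :=
      Set.eq_empty_of_forall_notMem fun x hx => (hx.trans_le (hule x)).not_ge ht
    have h2 : {x | ENNReal.ofReal t < v x} = ∅ :=
      Set.eq_empty_of_forall_notMem fun x hx => (hx.trans_le (hvle x)).not_ge ht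
    simp [h1, h2]

theorem lintegral_mul_lintegral_le_of_iSup_ne_top {u v w : ℝ → ENNReal}
    (hu : Measurable u) (hv : Measurable v) (hw : Measurable w)
    (hub : ⨆ x, u x ≠ ⊤) (hvb : ⨆ x, v x ≠ ⊤)
    (h : ∀ x y, u x * v y ≤ w ((2⁻¹ : ℝ) • (x + y)) ^ 2) :
    (∫⁻ x, u x) * ∫⁻ x, v x ≤ (∫⁻ x, w x) ^ 2 := by
  set a := ⨆ x, u x with ha
  set b := ⨆ x, v x with hb
  rcases eq_or_ne a 0 with ha0 | ha0
  · have : ∀ x, u x = 0 := fun x => le_antisymm (ha0 ▸ le_iSup u x) zero_le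
    simp [this]
  rcases eq_or_ne b 0 with hb0 | hb0
  · have : ∀ x, v x = 0 := fun x => le_antisymm (hb0 ▸ le_iSup v x) zero_le
    simp [this]
  obtain ⟨c, hc⟩ : ∃ c : ENNReal, c ^ 2 = a * b :=
    ⟨(a * b) ^ (2⁻¹ : ℝ), by rw [← ENNReal.rpow_natCast, ← ENNReal.rpow_mul]; norm_num⟩
  have hcinv : (c⁻¹) ^ 2 = a⁻¹ * b⁻¹ := by
    rw [← ENNReal.inv_pow, hc, ENNReal.mul_inv (Or.inl ha0) (Or.inl hub)]
  have hsum := lintegral_add_lintegral_le_of_iSup_eq_one (u := fun x => a⁻¹ * u x)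
    (v := fun x => b⁻¹ * v x) (w := fun x => c⁻¹ * w x) (hu.const_mul _) (hv.const_mul _)
    (hw.const_mul _) (by rw [← ENNReal.mul_iSup, ← ha, ENNReal.inv_mul_cancel ha0 hub])
    (by rw [← ENNReal.mul_iSup, ← hb, ENNReal.inv_mul_cancel hb0 hvb]) (fun x y => by
      refine (ENNReal.pow_le_pow_left_iff two_ne_zero).1 ?_
      rw [mul_pow, hcinv]
      calc min (a⁻¹ * u x) (b⁻¹ * v y) ^ 2 ≤ (a⁻¹ * u x) * (b⁻¹ * v y) := by
            rw [sq]; exact mul_le_mul' (min_le_left _ _) (min_le_right _ _)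
        _ = a⁻¹ * b⁻¹ * (u x * v y) := by ring
        _ ≤ _ := by gcongr; exact h x y)
  rw [lintegral_const_mul _ hu, lintegral_const_mul _ hv, lintegral_const_mul _ hw] at hsum
  have hsq := (four_mul_mul_le_add_sq _ _).trans (pow_le_pow_left₀ zero_le hsum 2)
  have hab : a * b ≠ 0 := mul_ne_zero ha0 hb0
  have hab' : a * b ≠ ⊤ := ENNReal.mul_ne_top hub hvb
  have heq : (4 * (a⁻¹ * b⁻¹)) * ((∫⁻ x, u x) * ∫⁻ x, v x) ≤
      (4 * (a⁻¹ * b⁻¹)) * (∫⁻ x, w x) ^ 2 := by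
    calc _ = 4 * ((a⁻¹ * ∫⁻ x, u x) * (b⁻¹ * ∫⁻ x, v x)) := by ring
      _ ≤ _ := hsq
      _ = _ := by rw [mul_pow, mul_pow, hcinv]; ring
  refine (ENNReal.mul_le_mul_iff_right ?_ ?_).1 heq
  · simp [hub, hvb]
  · exact ENNReal.mul_ne_top (by simp) (ENNReal.mul_ne_top (by simpa) (by simpa))

/-- The midpoint case of the Prékopa–Leindler inequality for a measure `μ`. -/
def SatisfiesPrekopaLeindler {E : Type*} [MeasurableSpace E] [Add E] [SMul ℝ E]
    (μ : Measure E) : Prop :=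
  ∀ ⦃u v w : E → ENNReal⦄, Measurable u → Measurable v → Measurable w →
    (∀ x y, u x * v y ≤ w ((2⁻¹ : ℝ) • (x + y)) ^ 2) →
    (∫⁻ x, u x ∂μ) * ∫⁻ x, v x ∂μ ≤ (∫⁻ x, w x ∂μ) ^ 2

theorem iSup_min_natCast (a : ENNReal) : ⨆ k : ℕ, min a k = a := by
  rw [← inf_iSup_eq, ENNReal.iSup_natCast, inf_top_eq]

theorem lintegral_eq_iSup_lintegral_min_natCast {α : Type*} [MeasurableSpace α] (μ : Measure α)
    {f : α → ENNReal} (hf : Measurable f) :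
    ∫⁻ x, f x ∂μ = ⨆ k : ℕ, ∫⁻ x, min (f x) k ∂μ := by
  rw [← lintegral_iSup (fun k => hf.min measurable_const)
    (fun i j hij x => min_le_min_left _ (by exact_mod_cast hij))]
  simp only [iSup_min_natCast]

theorem satisfiesPrekopaLeindler_real : SatisfiesPrekopaLeindler (volume : Measure ℝ) := by
  intro u v w hu hv hw h
  rw [lintegral_eq_iSup_lintegral_min_natCast volume hu,
    lintegral_eq_iSup_lintegral_min_natCast volume hv, ENNReal.iSup_mul]
  refine iSup_le fun k => ?_
  rw [ENNReal.mul_iSup]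
  refine iSup_le fun l => ?_
  refine lintegral_mul_lintegral_le_of_iSup_ne_top (hu.min measurable_const)
    (hv.min measurable_const) hw ?_ ?_ fun x y =>
      (mul_le_mul' (min_le_left _ _) (min_le_left _ _)).trans (h x y)
  · exact ((iSup_le fun x => min_le_right _ _).trans_lt (ENNReal.natCast_lt_top k)).ne
  · exact ((iSup_le fun x => min_le_right _ _).trans_lt (ENNReal.natCast_lt_top l)).ne

theorem SatisfiesPrekopaLeindler.prod {E F : Type*} [MeasurableSpace E] [Add E] [SMul ℝ E]
    [MeasurableSpace F] [Add F] [SMul ℝ F] {μ : Measure E} {ν : Measure F} [SFinite ν]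
    (hμ : SatisfiesPrekopaLeindler μ) (hν : SatisfiesPrekopaLeindler ν) :
    SatisfiesPrekopaLeindler (μ.prod ν) := by
  intro u v w hu hv hw h
  rw [lintegral_prod _ hu.aemeasurable, lintegral_prod _ hv.aemeasurable,
    lintegral_prod _ hw.aemeasurable]
  refine hμ hu.lintegral_prod_right' hv.lintegral_prod_right' hw.lintegral_prod_right' ?_
  intro x y
  exact hν (hu.comp measurable_prodMk_left) (hv.comp measurable_prodMk_left)
    (hw.comp measurable_prodMk_left) fun x' y' => h (x, x') (y, y')

theorem SatisfiesPrekopaLeindler.of_measurePreserving {E F : Type*} [MeasurableSpace E] [Add E]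
    [SMul ℝ E] [MeasurableSpace F] [Add F] [SMul ℝ F] {μ : Measure E} {ν : Measure F}
    (hμ : SatisfiesPrekopaLeindler μ) {g : E → F} (hg : MeasurePreserving g μ ν)
    (hmid : ∀ x y, g ((2⁻¹ : ℝ) • (x + y)) = (2⁻¹ : ℝ) • (g x + g y)) :
    SatisfiesPrekopaLeindler ν := by
  intro u v w hu hv hw h
  rw [← hg.lintegral_comp hu, ← hg.lintegral_comp hv, ← hg.lintegral_comp hw]
  refine hμ (hu.comp hg.measurable) (hv.comp hg.measurable) (hw.comp hg.measurable) fun x y => ?_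
  rw [hmid]
  exact h _ _

theorem satisfiesPrekopaLeindler_pi (n : ℕ) :
    SatisfiesPrekopaLeindler (volume : Measure (Fin n → ℝ)) := by
  induction n with
  | zero =>
    intro u v w _ _ _ h
    rw [volume_pi, Measure.pi_of_empty _ 0]
    have := h 0 0
    simpa [lintegral_dirac] using this
  | succ n ih =>
    refine (satisfiesPrekopaLeindler_real.prod ih).of_measurePreserving
      (volume_preserving_piFinSuccAbove (fun _ => ℝ) (0 : Fin (n + 1))).symm fun x y => ?_
    ext i
    refine Fin.cases ?_ (fun j => ?_) i <;>
    simp [MeasurableEquiv.piFinSuccAbove, Fin.insertNthEquiv, mul_add]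

theorem satisfiesPrekopaLeindler_euclideanSpace (n : ℕ) :
    SatisfiesPrekopaLeindler (volume : Measure (EuclideanSpace ℝ (Fin n))) :=
  (satisfiesPrekopaLeindler_pi n).of_measurePreserving (PiLp.volume_preserving_toLp (Fin n))
    fun _ _ => rfl

theorem setDist_nonneg {X : Type*} [MetricSpace X] (A B : Set X) : 0 ≤ setDist A B := by
  refine Real.sInf_nonneg ?_
  rintro _ ⟨a, _, b, _, rfl⟩
  exact dist_nonneg

theorem setDist_le_dist {X : Type*} [MetricSpace X] {A B : Set X} {a b : X} (ha : a ∈ A)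
    (hb : b ∈ B) : setDist A B ≤ dist a b := by
  refine csInf_le ⟨0, ?_⟩ ⟨a, ha, b, hb, rfl⟩
  rintro _ ⟨a, _, b, _, rfl⟩
  exact dist_nonneg

theorem lintegral_heatKernel (n : ℕ) {τ : ℝ} (hτ : 0 < τ) (x₀ : EuclideanSpace ℝ (Fin n)) :
    ∫⁻ y, ENNReal.ofReal
      ((4 * π * τ) ^ (-(n : ℝ) / 2) * Real.exp (-‖y - x₀‖ ^ 2 / (4 * τ))) = 1 := by
  have hgauss : ∫ y : EuclideanSpace ℝ (Fin n), Real.exp (-(4 * τ)⁻¹ * ‖y‖ ^ 2) =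
      (4 * π * τ) ^ ((n : ℝ) / 2) := by
    rw [GaussianFourier.integral_rexp_neg_mul_sq_norm (by positivity), finrank_euclideanSpace,
      Fintype.card_fin]
    congr 1
    field_simp
  have hpos : 0 < (4 * π * τ) ^ ((n : ℝ) / 2) := by positivity
  have hi : Integrable fun y : EuclideanSpace ℝ (Fin n) => Real.exp (-(4 * τ)⁻¹ * ‖y‖ ^ 2) :=
    Integrable.of_integral_ne_zero (by rw [hgauss]; exact hpos.ne')
  have hshift := lintegral_sub_right_eq_self (μ := volume) (fun y : EuclideanSpace ℝ (Fin n) =>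
    ENNReal.ofReal ((4 * π * τ) ^ (-(n : ℝ) / 2) * Real.exp (-‖y‖ ^ 2 / (4 * τ)))) x₀
  rw [hshift]
  have hexp : ∀ y : EuclideanSpace ℝ (Fin n), -‖y‖ ^ 2 / (4 * τ) = -(4 * τ)⁻¹ * ‖y‖ ^ 2 :=
    fun y => by ring
  simp only [hexp]
  rw [← ofReal_integral_eq_lintegral_ofReal (hi.const_mul _)
    (Filter.Eventually.of_forall fun y => by dsimp; positivity), integral_const_mul, hgauss,
    ← Real.rpow_add (by positivity)]
  simp [neg_div]

theorem norm_midpoint_sub_sq {E : Type*} [NormedAddCommGroup E] [InnerProductSpace ℝ E]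
    (x y z : E) :
    ‖(2⁻¹ : ℝ) • (x + y) - z‖ ^ 2 = (‖x - z‖ ^ 2 + ‖y - z‖ ^ 2) / 2 - dist x y ^ 2 / 4 := by
  have h := parallelogram_law_with_norm ℝ (x - z) (y - z)
  have h1 : (2⁻¹ : ℝ) • (x + y) - z = (2⁻¹ : ℝ) • ((x - z) + (y - z)) := by module
  have h2 : x - z - (y - z) = x - y := by abel
  rw [h2] at h
  rw [h1, norm_smul, dist_eq_norm, mul_pow]
  norm_num
  linarith

theorem gaussian_kernel_mul_le {E : Type*} [NormedAddCommGroup E] [InnerProductSpace ℝ E]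
    {τ c d : ℝ} (hτ : 0 < τ) (hd : 0 ≤ d) {x y : E} (hxy : d ≤ dist x y) (z : E) :
    c * Real.exp (-‖x - z‖ ^ 2 / (4 * τ)) *
        (Real.exp (d ^ 2 / (8 * τ)) * (c * Real.exp (-‖y - z‖ ^ 2 / (4 * τ)))) ≤
      (c * Real.exp (-‖(2⁻¹ : ℝ) • (x + y) - z‖ ^ 2 / (4 * τ))) ^ 2 := by
  have hsq : d ^ 2 ≤ dist x y ^ 2 := pow_le_pow_left₀ hd hxy 2
  have hexp : -‖x - z‖ ^ 2 / (4 * τ) + (d ^ 2 / (8 * τ) + -‖y - z‖ ^ 2 / (4 * τ)) ≤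
      2 * (-‖(2⁻¹ : ℝ) • (x + y) - z‖ ^ 2 / (4 * τ)) := by
    rw [norm_midpoint_sub_sq]
    have h : 0 ≤ (dist x y ^ 2 - d ^ 2) / (8 * τ) :=
      div_nonneg (sub_nonneg.2 hsq) (by positivity)
    refine sub_nonneg.1 (h.trans_eq ?_)
    field_simp
    ring
  calc _ = c ^ 2 * Real.exp
        (-‖x - z‖ ^ 2 / (4 * τ) + (d ^ 2 / (8 * τ) + -‖y - z‖ ^ 2 / (4 * τ))) := by
        rw [Real.exp_add, Real.exp_add]; ring
    _ ≤ c ^ 2 * Real.exp (2 * (-‖(2⁻¹ : ℝ) • (x + y) - z‖ ^ 2 / (4 * τ))) := by gcongr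
    _ = _ := by rw [two_mul, Real.exp_add]; ring

/-- Gaussian concentration inequality (Theorem 1.7 of Hein–Naber) for the conjugate
heat kernel measure of the static flat Ricci flow on `ℝⁿ`, with `|s| = τ`. -/
theorem gaussian_concentration_heatGaussian (n : ℕ) (hn : 1 ≤ n) (τ : ℝ) (hτ : 0 < τ)
    (x₀ : EuclideanSpace ℝ (Fin n)) (A B : Set (EuclideanSpace ℝ (Fin n)))
    (hA : MeasurableSet A) (hB : MeasurableSet B)
    (hAne : A.Nonempty) (hBne : B.Nonempty) :
    heatGaussian n τ x₀ A * heatGaussian n τ x₀ B ≤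
      ENNReal.ofReal (Real.exp (-(setDist A B) ^ 2 / (8 * τ))) := by
  set p : EuclideanSpace ℝ (Fin n) → ENNReal := fun y =>
    ENNReal.ofReal ((4 * π * τ) ^ (-(n : ℝ) / 2) * Real.exp (-‖y - x₀‖ ^ 2 / (4 * τ))) with hp
  have hpm : Measurable p := by fun_prop
  set e : ENNReal := ENNReal.ofReal (Real.exp (setDist A B ^ 2 / (8 * τ))) with he
  have hpl := satisfiesPrekopaLeindler_euclideanSpace n (hpm.indicator hA)
    ((hpm.const_mul e).indicator hB) hpm (fun x y => by
      by_cases hx : x ∈ A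
      · by_cases hy : y ∈ B
        · rw [Set.indicator_of_mem hx, Set.indicator_of_mem hy]
          simp only [hp, he]
          rw [← ENNReal.ofReal_mul (by positivity), ← ENNReal.ofReal_mul (by positivity),
            ← ENNReal.ofReal_pow (by positivity)]
          exact ENNReal.ofReal_le_ofReal (gaussian_kernel_mul_le hτ (setDist_nonneg A B)
            (setDist_le_dist hx hy) x₀)
        · simp [hy]
      · simp [hx])
  rw [lintegral_indicator hA, lintegral_indicator hB, lintegral_const_mul _ hpm,
    lintegral_heatKernel n hτ, one_pow] at hpl
  rw [heatGaussian, withDensity_apply _ hA, withDensity_apply _ hB,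
    neg_div (8 * τ) (setDist A B ^ 2), Real.exp_neg,
    ENNReal.ofReal_inv_of_pos (Real.exp_pos _), ENNReal.le_inv_iff_mul_le]
  calc _ = (∫⁻ y in A, p y) * (e * ∫⁻ y in B, p y) := by ring
    _ ≤ 1 := hpl
end

section
/- (Entropy interpolation along the heat semigroup.) Let n ≥ 1, let ε > 0 and let v : ℝⁿ → ℝ be smooth, nonnegative and compactly supported, and set u = ε + v (so u is smooth, positive, bounded, and constant outside a compact set). Then for every t > 0 and x₀ ∈ ℝⁿ: P_t(u·log u)(x₀) - P_t u(x₀)·log(P_t u(x₀)) = ∫₀ᵗ P_{t-r}( ‖∇(P_r u)‖² / (P_r u) )(x₀) dr. -/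
open MeasureTheory Real

/-- The Euclidean heat semigroup on `ℝⁿ`: `(P_t f)(x) = ∫ f(y)·k_t(x,y) dy` for `t > 0`,
with heat kernel `k_t(x,y) = (4πt)^{-n/2}·exp(-‖x-y‖²/(4t))`, and `P_0 f = f`. -/
noncomputable def heatSemigroup (n : ℕ) (t : ℝ) (f : EuclideanSpace ℝ (Fin n) → ℝ)
    (x : EuclideanSpace ℝ (Fin n)) : ℝ :=
  if t = 0 then f x
  else ∫ y, f y * ((4 * π * t) ^ (-(n : ℝ) / 2) * Real.exp (-‖x - y‖ ^ 2 / (4 * t)))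

/-- The density of the heat kernel at time `1`, centred at the origin. -/
noncomputable def heatDensity (n : ℕ) (z : EuclideanSpace ℝ (Fin n)) : ℝ :=
  (4 * π) ^ (-(n : ℝ) / 2) * Real.exp (-‖z‖ ^ 2 / 4)

/-- The law at time `1` of the heat flow started at the origin. -/
noncomputable def heatMeasure (n : ℕ) : Measure (EuclideanSpace ℝ (Fin n)) :=
  volume.withDensity fun z => ENNReal.ofReal (heatDensity n z)

section HeatMeasure

variable {n : ℕ}

lemma heatDensity_nonneg (z : EuclideanSpace ℝ (Fin n)) : 0 ≤ heatDensity n z := by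
  unfold heatDensity; positivity

lemma continuous_heatDensity : Continuous (heatDensity n) := by
  unfold heatDensity; fun_prop

lemma integrable_exp_neg_mul_norm_sq {b : ℝ} (hb : 0 < b) :
    Integrable (fun z : EuclideanSpace ℝ (Fin n) => Real.exp (-b * ‖z‖ ^ 2)) := by
  have h := (GaussianFourier.integrable_cexp_neg_mul_sq_norm_add (V := EuclideanSpace ℝ (Fin n))
    (b := (b : ℂ)) (by simpa using hb) 0 0).norm
  refine h.congr (Filter.Eventually.of_forall fun z => ?_)
  simp [Complex.norm_exp, ← Complex.ofReal_pow]

lemma integrable_heatDensity : Integrable (heatDensity n) := by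
  refine ((integrable_exp_neg_mul_norm_sq (n := n) (b := 1 / 4) (by norm_num)).const_mul
    ((4 * π) ^ (-(n : ℝ) / 2))).congr (Filter.Eventually.of_forall fun z => ?_)
  simp only [heatDensity]
  ring_nf

lemma integral_heatDensity : ∫ z, heatDensity n z = 1 := by
  have h := GaussianFourier.integral_rexp_neg_mul_sq_norm
    (V := EuclideanSpace ℝ (Fin n)) (b := 1 / 4) (by norm_num)
  have h2 : ∀ z : EuclideanSpace ℝ (Fin n), heatDensity n z =
      (4 * π) ^ (-(n : ℝ) / 2) * Real.exp (-(1 / 4) * ‖z‖ ^ 2) := by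
    intro z; simp only [heatDensity]; ring_nf
  simp_rw [h2]
  rw [integral_const_mul, h, finrank_euclideanSpace_fin,
    show π / (1 / 4) = 4 * π by ring, ← Real.rpow_add (by positivity)]
  simp [neg_div]

lemma integral_heatMeasure (f : EuclideanSpace ℝ (Fin n) → ℝ) :
    ∫ z, f z ∂heatMeasure n = ∫ z, f z * heatDensity n z := by
  rw [heatMeasure, integral_withDensity_eq_integral_toReal_smul
    (continuous_heatDensity.measurable.ennreal_ofReal) (by simp)]
  simp [ENNReal.toReal_ofReal (heatDensity_nonneg _), mul_comm]

lemma integrable_heatMeasure_iff {f : EuclideanSpace ℝ (Fin n) → ℝ} :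
    Integrable f (heatMeasure n) ↔ Integrable fun z => f z * heatDensity n z := by
  rw [heatMeasure, integrable_withDensity_iff
    (continuous_heatDensity.measurable.ennreal_ofReal) (by simp)]
  simp [ENNReal.toReal_ofReal (heatDensity_nonneg _)]

instance : IsProbabilityMeasure (heatMeasure n) := by
  constructor
  rw [heatMeasure, withDensity_apply _ MeasurableSet.univ, Measure.restrict_univ,
    ← ofReal_integral_eq_lintegral_ofReal integrable_heatDensity
      (Filter.Eventually.of_forall heatDensity_nonneg), integral_heatDensity, ENNReal.ofReal_one]

lemma integrable_norm_heatMeasure :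
    Integrable (fun z : EuclideanSpace ℝ (Fin n) => ‖z‖) (heatMeasure n) := by
  rw [integrable_heatMeasure_iff]
  refine ((integrable_exp_neg_mul_norm_sq (n := n) (b := 1 / 8) (by norm_num)).const_mul
    (8 * (4 * π) ^ (-(n : ℝ) / 2))).mono'
      (continuous_norm.mul continuous_heatDensity).aestronglyMeasurable
      (Filter.Eventually.of_forall fun z => ?_)
  rw [Real.norm_of_nonneg (mul_nonneg (norm_nonneg _) (heatDensity_nonneg _)), heatDensity,
    show -‖z‖ ^ 2 / 4 = ‖z‖ ^ 2 * (-1 / 8) + -(1 / 8) * ‖z‖ ^ 2 by ring, Real.exp_add]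
  have h1 : ‖z‖ * Real.exp (‖z‖ ^ 2 * (-1 / 8)) ≤ 8 := by
    have h3 := Real.add_one_le_exp (‖z‖ ^ 2 * (1 / 8))
    have h4 : Real.exp (‖z‖ ^ 2 * (1 / 8)) * Real.exp (‖z‖ ^ 2 * (-1 / 8)) = 1 := by
      rw [← Real.exp_add, ← mul_add]; norm_num
    calc ‖z‖ * Real.exp (‖z‖ ^ 2 * (-1 / 8))
        ≤ (8 * Real.exp (‖z‖ ^ 2 * (1 / 8))) * Real.exp (‖z‖ ^ 2 * (-1 / 8)) := by
          gcongr
          nlinarith [sq_nonneg (‖z‖ - 1)]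
      _ = 8 := by rw [mul_assoc, h4, mul_one]
  calc ‖z‖ * ((4 * π) ^ (-(n : ℝ) / 2) *
        (Real.exp (‖z‖ ^ 2 * (-1 / 8)) * Real.exp (-(1 / 8) * ‖z‖ ^ 2)))
      = (‖z‖ * Real.exp (‖z‖ ^ 2 * (-1 / 8))) *
        ((4 * π) ^ (-(n : ℝ) / 2) * Real.exp (-(1 / 8) * ‖z‖ ^ 2)) := by ring
    _ ≤ 8 * ((4 * π) ^ (-(n : ℝ) / 2) * Real.exp (-(1 / 8) * ‖z‖ ^ 2)) := by gcongr
    _ = _ := by ring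

lemma hasFDerivAt_heatDensity (z : EuclideanSpace ℝ (Fin n)) :
    HasFDerivAt (heatDensity n) (-(heatDensity n z / 2) • innerSL ℝ z) z := by
  have h := ((((hasStrictFDerivAt_norm_sq z).hasFDerivAt.neg).mul_const (1 / 4 : ℝ)).exp).const_mul
    ((4 * π) ^ (-(n : ℝ) / 2))
  have h2 : heatDensity n = fun z => (4 * π) ^ (-(n : ℝ) / 2) *
      Real.exp (-‖z‖ ^ 2 * (1 / 4)) := by
    ext z; simp only [heatDensity]; ring_nf
  rw [h2]
  refine h.congr_fderiv ?_
  ext y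
  simp
  ring

lemma heatSemigroup_eq_integral_heatMeasure {t : ℝ} (ht : 0 ≤ t)
    (f : EuclideanSpace ℝ (Fin n) → ℝ) (x : EuclideanSpace ℝ (Fin n)) :
    heatSemigroup n t f x = ∫ z, f (x + √t • z) ∂heatMeasure n := by
  rcases ht.eq_or_lt with rfl | ht
  · simp [heatSemigroup]
  have hs : 0 < √t := Real.sqrt_pos.2 ht
  rw [heatSemigroup, if_neg ht.ne', integral_heatMeasure]
  rw [← integral_add_left_eq_self _ x]
  have hc := Measure.integral_comp_smul (volume : Measure (EuclideanSpace ℝ (Fin n)))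
    (fun y => f (x + y) * ((4 * π * t) ^ (-(n : ℝ) / 2) *
      Real.exp (-‖x - (x + y)‖ ^ 2 / (4 * t)))) (√t)
  rw [finrank_euclideanSpace_fin, abs_of_pos (by positivity), smul_eq_mul,
    eq_inv_mul_iff_mul_eq₀ (by positivity)] at hc
  rw [← hc, ← integral_const_mul]
  congr 1
  ext z
  have h1 : (4 * π * t) ^ (-(n : ℝ) / 2) = (4 * π) ^ (-(n : ℝ) / 2) * (√t ^ n)⁻¹ := by
    rw [Real.mul_rpow (by positivity) ht.le, Real.sqrt_eq_rpow, ← Real.rpow_natCast,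
      ← Real.rpow_mul ht.le, ← Real.rpow_neg ht.le]
    congr 2; ring
  have h2 : -‖x - (x + √t • z)‖ ^ 2 / (4 * t) = -‖z‖ ^ 2 / 4 := by
    rw [sub_add_cancel_left, norm_neg, norm_smul, Real.norm_of_nonneg hs.le, mul_pow,
      Real.sq_sqrt ht.le]
    field_simp
  rw [h1, h2, heatDensity]
  field_simp

/-- Gaussian integration by parts. -/
lemma integral_mul_coord_heatMeasure {g : EuclideanSpace ℝ (Fin n) → ℝ} (hg : Differentiable ℝ g)
    {C C' : ℝ} (hC : ∀ z, |g z| ≤ C) (hC' : ∀ z, ‖fderiv ℝ g z‖ ≤ C') (i : Fin n) :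
    ∫ z, g z * z i ∂heatMeasure n =
      2 * ∫ z, fderiv ℝ g z (EuclideanSpace.single i 1) ∂heatMeasure n := by
  have hd : ∀ z : EuclideanSpace ℝ (Fin n),
      fderiv ℝ (heatDensity n) z (EuclideanSpace.single i 1) = -(1 / 2) * (z i * heatDensity n z) := by
    intro z
    rw [(hasFDerivAt_heatDensity z).fderiv]
    simp [EuclideanSpace.inner_single_right]
    ring
  have h1 : Integrable (fun z => fderiv ℝ g z (EuclideanSpace.single i 1)) (heatMeasure n) := by
    refine Integrable.of_bound (measurable_fderiv_apply_const ℝ g _).aestronglyMeasurable C'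
      (Filter.Eventually.of_forall fun z => ?_)
    refine ((fderiv ℝ g z).le_opNorm _).trans ?_
    simpa using hC' z
  have h2 : Integrable (fun z => g z * z i) (heatMeasure n) := by
    refine (integrable_norm_heatMeasure.const_mul C).mono'
      (hg.continuous.mul (by fun_prop)).aestronglyMeasurable
      (Filter.Eventually.of_forall fun z => ?_)
    rw [norm_mul]
    exact mul_le_mul (hC z) (PiLp.norm_apply_le z i) (norm_nonneg _) ((abs_nonneg _).trans (hC z))
  have h3 : Integrable g (heatMeasure n) :=
    Integrable.of_bound hg.continuous.aestronglyMeasurable C (Filter.Eventually.of_forall hC)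
  rw [integrable_heatMeasure_iff] at h1 h2 h3
  have key := integral_mul_fderiv_eq_neg_fderiv_mul_of_integrable (μ := volume)
    (f := g) (g := heatDensity n) (v := EuclideanSpace.single i 1) h1
    (by
      refine (h2.const_mul (-(1 / 2))).congr (Filter.Eventually.of_forall fun z => ?_)
      simp only [hd]; ring) h3
    (fun z _ => hg z) (fun z _ => (hasFDerivAt_heatDensity z).differentiableAt)
  rw [integral_heatMeasure, integral_heatMeasure]
  have h4 : ∀ z, g z * fderiv ℝ (heatDensity n) z (EuclideanSpace.single i 1) =
      -(1 / 2) * (g z * z i * heatDensity n z) := by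
    intro z; rw [hd]; ring
  simp_rw [h4] at key
  rw [integral_const_mul] at key
  linarith

end HeatMeasure

/-- The Gaussian average of `f` at scale `√r`, centred at `x`; it is the heat semigroup at time
`r ≥ 0`, see `heatSemigroup_eq_heatAverage`. -/
noncomputable def heatAverage {n : ℕ} {F : Type*} [NormedAddCommGroup F] [NormedSpace ℝ F]
    (f : EuclideanSpace ℝ (Fin n) → F) (r : ℝ) (x : EuclideanSpace ℝ (Fin n)) : F :=
  ∫ z, f (x + √r • z) ∂heatMeasure n

/-- The `i`-th partial derivative. -/
noncomputable def partialDeriv {n : ℕ} (i : Fin n) (f : EuclideanSpace ℝ (Fin n) → ℝ)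
    (x : EuclideanSpace ℝ (Fin n)) : ℝ :=
  fderiv ℝ f x (EuclideanSpace.single i 1)

/-- Bounded `C¹` functions with bounded derivative. -/
structure BoundedC1 {n : ℕ} (f : EuclideanSpace ℝ (Fin n) → ℝ) : Prop where
  contDiff : ContDiff ℝ 1 f
  bdd : ∃ C, ∀ x, |f x| ≤ C
  bdd_fderiv : ∃ C, ∀ x, ‖fderiv ℝ f x‖ ≤ C

lemma abs_log_le {a b x : ℝ} (ha : 0 < a) (hax : a ≤ x) (hxb : x ≤ b) :
    |Real.log x| ≤ |Real.log a| + |Real.log b| := by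
  have h1 := Real.log_le_log ha hax
  have h2 := Real.log_le_log (ha.trans_le hax) hxb
  rw [abs_le]
  constructor
  · linarith [neg_abs_le (Real.log a), abs_nonneg (Real.log b)]
  · linarith [le_abs_self (Real.log b), abs_nonneg (Real.log a)]

namespace BoundedC1

variable {n : ℕ} {f g : EuclideanSpace ℝ (Fin n) → ℝ}

lemma differentiable (hf : BoundedC1 f) : Differentiable ℝ f :=
  hf.contDiff.differentiable (by simp)

lemma continuous (hf : BoundedC1 f) : Continuous f := hf.contDiff.continuous

lemma continuous_fderiv (hf : BoundedC1 f) : Continuous (fderiv ℝ f) :=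
  hf.contDiff.continuous_fderiv (by simp)

lemma of_hasCompactSupport (hf : ContDiff ℝ 1 f) (hs : HasCompactSupport f) : BoundedC1 f where
  contDiff := hf
  bdd := hs.exists_bound_of_continuous hf.continuous
  bdd_fderiv := (hs.fderiv ℝ).exists_bound_of_continuous (hf.continuous_fderiv (by simp))

lemma const_add (hf : BoundedC1 f) (c : ℝ) : BoundedC1 fun x => c + f x where
  contDiff := contDiff_const.add hf.contDiff
  bdd := by
    obtain ⟨C, hC⟩ := hf.bdd
    exact ⟨|c| + C, fun x => (abs_add_le _ _).trans (by linarith [hC x])⟩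
  bdd_fderiv := by
    obtain ⟨C, hC⟩ := hf.bdd_fderiv
    exact ⟨C, fun x => by simpa using hC x⟩

lemma mul (hf : BoundedC1 f) (hg : BoundedC1 g) : BoundedC1 fun x => f x * g x where
  contDiff := hf.contDiff.mul hg.contDiff
  bdd := by
    obtain ⟨A, hA⟩ := hf.bdd
    obtain ⟨B, hB⟩ := hg.bdd
    refine ⟨A * B, fun x => ?_⟩
    rw [abs_mul]
    exact mul_le_mul (hA x) (hB x) (abs_nonneg _) ((abs_nonneg _).trans (hA x))
  bdd_fderiv := by
    obtain ⟨A, hA⟩ := hf.bdd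
    obtain ⟨B, hB⟩ := hg.bdd
    obtain ⟨A', hA'⟩ := hf.bdd_fderiv
    obtain ⟨B', hB'⟩ := hg.bdd_fderiv
    refine ⟨A * B' + B * A', fun x => ?_⟩
    rw [fderiv_fun_mul (hf.differentiable x) (hg.differentiable x)]
    refine (norm_add_le _ _).trans ?_
    rw [norm_smul, norm_smul]
    exact add_le_add
      (mul_le_mul (hA x) (hB' x) (norm_nonneg _) ((abs_nonneg _).trans (hA x)))
      (mul_le_mul (hB x) (hA' x) (norm_nonneg _) ((abs_nonneg _).trans (hB x)))

lemma log (hf : BoundedC1 f) {ε : ℝ} (hε : 0 < ε) (h : ∀ x, ε ≤ f x) :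
    BoundedC1 fun x => Real.log (f x) where
  contDiff := hf.contDiff.log fun x => (hε.trans_le (h x)).ne'
  bdd := by
    obtain ⟨C, hC⟩ := hf.bdd
    exact ⟨_, fun x => abs_log_le hε (h x) ((le_abs_self _).trans (hC x))⟩
  bdd_fderiv := by
    obtain ⟨C, hC⟩ := hf.bdd_fderiv
    refine ⟨ε⁻¹ * C, fun x => ?_⟩
    have hx := hε.trans_le (h x)
    rw [((hf.differentiable x).hasFDerivAt.log hx.ne').fderiv, norm_smul, norm_inv,
      Real.norm_of_nonneg hx.le]
    exact mul_le_mul (inv_anti₀ hε (h x)) (hC x) (norm_nonneg _) (by positivity)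

end BoundedC1

section HeatAverage

variable {n : ℕ} {F : Type*} [NormedAddCommGroup F] [NormedSpace ℝ F]
  {f : EuclideanSpace ℝ (Fin n) → ℝ}

lemma heatSemigroup_eq_heatAverage {t : ℝ} (ht : 0 ≤ t) (f : EuclideanSpace ℝ (Fin n) → ℝ) :
    heatSemigroup n t f = heatAverage f t :=
  funext (heatSemigroup_eq_integral_heatMeasure ht f)

lemma heatAverage_zero (f : EuclideanSpace ℝ (Fin n) → ℝ) : heatAverage f 0 = f := by
  ext x; simp [heatAverage]

lemma norm_heatAverage_le {g : EuclideanSpace ℝ (Fin n) → F} {C : ℝ} (hC : ∀ x, ‖g x‖ ≤ C)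
    (r : ℝ) (x : EuclideanSpace ℝ (Fin n)) : ‖heatAverage g r x‖ ≤ C := by
  simpa [heatAverage] using norm_integral_le_of_norm_le_const (μ := heatMeasure n)
    (Filter.Eventually.of_forall fun z => hC (x + √r • z))

lemma integrable_heatAverage {G : Type*} [NormedAddCommGroup G]
    {g : EuclideanSpace ℝ (Fin n) → G} (hg : Continuous g) {C : ℝ}
    (hC : ∀ x, ‖g x‖ ≤ C) (r : ℝ) (x : EuclideanSpace ℝ (Fin n)) :
    Integrable (fun z => g (x + √r • z)) (heatMeasure n) :=
  Integrable.of_bound (hg.comp (by fun_prop)).aestronglyMeasurable C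
    (Filter.Eventually.of_forall fun z => hC _)

lemma le_heatAverage (hf : Continuous f) {C : ℝ} (hC : ∀ x, |f x| ≤ C) {ε : ℝ}
    (h : ∀ x, ε ≤ f x) (r : ℝ) (x : EuclideanSpace ℝ (Fin n)) : ε ≤ heatAverage f r x := by
  have := integral_mono (integrable_const ε) (integrable_heatAverage hf hC r x)
    (fun z => h (x + √r • z))
  simpa [heatAverage] using this

lemma continuous_heatAverage {g : EuclideanSpace ℝ (Fin n) → F} (hg : Continuous g) {C : ℝ}
    (hC : ∀ x, ‖g x‖ ≤ C) :
    Continuous fun p : ℝ × EuclideanSpace ℝ (Fin n) => heatAverage g p.1 p.2 :=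
  continuous_of_dominated
    (fun p => (integrable_heatAverage hg hC p.1 p.2).aestronglyMeasurable)
    (fun _ => Filter.Eventually.of_forall fun _ => hC _) (integrable_const C)
    (Filter.Eventually.of_forall fun _ => hg.comp (by fun_prop))

lemma BoundedC1.hasFDerivAt_heatAverage (hf : BoundedC1 f) (r : ℝ)
    (x : EuclideanSpace ℝ (Fin n)) :
    HasFDerivAt (heatAverage f r) (heatAverage (fderiv ℝ f) r x) x := by
  obtain ⟨A, hA⟩ := hf.bdd
  obtain ⟨C, hC⟩ := hf.bdd_fderiv
  refine hasFDerivAt_integral_of_dominated_of_fderiv_le (F' := fun x z => fderiv ℝ f (x + √r • z))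
    (bound := fun _ => C) Filter.univ_mem
    (Filter.Eventually.of_forall fun x =>
      (integrable_heatAverage hf.continuous hA r x).aestronglyMeasurable)
    (integrable_heatAverage hf.continuous hA r x)
    (integrable_heatAverage hf.continuous_fderiv hC r x).aestronglyMeasurable
    (Filter.Eventually.of_forall fun z x _ => hC _) (integrable_const C)
    (Filter.Eventually.of_forall fun z x _ => ?_)
  have h := (hf.differentiable (x + √r • z)).hasFDerivAt.comp x
    ((hasFDerivAt_id x).add_const (√r • z))
  simpa [Function.comp_def] using h

lemma BoundedC1.fderiv_heatAverage (hf : BoundedC1 f) (r : ℝ) :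
    fderiv ℝ (heatAverage f r) = heatAverage (fderiv ℝ f) r :=
  funext fun x => (hf.hasFDerivAt_heatAverage r x).fderiv

lemma BoundedC1.heatAverage_fderiv_apply (hf : BoundedC1 f) (r : ℝ)
    (x y : EuclideanSpace ℝ (Fin n)) :
    heatAverage (fderiv ℝ f) r x y = ∫ z, fderiv ℝ f (x + √r • z) y ∂heatMeasure n := by
  obtain ⟨C, hC⟩ := hf.bdd_fderiv
  exact ContinuousLinearMap.integral_apply (integrable_heatAverage hf.continuous_fderiv hC r x) y

lemma BoundedC1.heatAverage (hf : BoundedC1 f) (r : ℝ) : BoundedC1 (heatAverage f r) where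
  contDiff := by
    obtain ⟨C, hC⟩ := hf.bdd_fderiv
    rw [contDiff_one_iff_fderiv, hf.fderiv_heatAverage]
    exact ⟨fun x => (hf.hasFDerivAt_heatAverage r x).differentiableAt,
      (continuous_heatAverage hf.continuous_fderiv hC).comp (Continuous.prodMk_right r)⟩
  bdd := by
    obtain ⟨C, hC⟩ := hf.bdd
    exact ⟨C, norm_heatAverage_le (g := f) hC r⟩
  bdd_fderiv := by
    obtain ⟨C, hC⟩ := hf.bdd_fderiv
    rw [hf.fderiv_heatAverage]
    exact ⟨C, norm_heatAverage_le hC r⟩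

lemma BoundedC1.partialDeriv_heatAverage (hf : BoundedC1 f) (r : ℝ) (i : Fin n) :
    partialDeriv i (_root_.heatAverage f r) = _root_.heatAverage (partialDeriv i f) r := by
  ext x
  rw [partialDeriv, hf.fderiv_heatAverage, hf.heatAverage_fderiv_apply]
  rfl

lemma fderiv_apply_eq_sum_partialDeriv (f : EuclideanSpace ℝ (Fin n) → ℝ)
    (x z : EuclideanSpace ℝ (Fin n)) :
    fderiv ℝ f x z = ∑ i, partialDeriv i f x * z i := by
  conv_lhs => rw [← (EuclideanSpace.basisFun (Fin n) ℝ).sum_repr z]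
  simp [partialDeriv, mul_comm]

lemma norm_gradient_sq_eq_sum (f : EuclideanSpace ℝ (Fin n) → ℝ)
    (x : EuclideanSpace ℝ (Fin n)) :
    ‖gradient f x‖ ^ 2 = ∑ i, partialDeriv i f x ^ 2 := by
  rw [EuclideanSpace.norm_sq_eq]
  refine Finset.sum_congr rfl fun i _ => ?_
  have h : inner ℝ (gradient f x) (EuclideanSpace.single i 1) = partialDeriv i f x :=
    InnerProductSpace.toDual_symm_apply
  rw [← h, EuclideanSpace.inner_single_right]
  simp

lemma abs_partialDeriv_le {C : ℝ} (hC : ∀ x, ‖fderiv ℝ f x‖ ≤ C) (i : Fin n)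
    (x : EuclideanSpace ℝ (Fin n)) : |partialDeriv i f x| ≤ C :=
  ((fderiv ℝ f x).le_opNorm _).trans (by simpa using hC x)

lemma BoundedC1.continuous_partialDeriv (hf : BoundedC1 f) (i : Fin n) :
    Continuous (partialDeriv i f) :=
  hf.continuous_fderiv.clm_apply continuous_const

/-- Gaussian integration by parts for the radial derivative. -/
lemma integral_fderiv_apply_self_heatMeasure (hf : ∀ i, BoundedC1 (partialDeriv i f)) {s : ℝ}
    (x : EuclideanSpace ℝ (Fin n)) :
    ∫ z, fderiv ℝ f (x + √s • z) z ∂heatMeasure n =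
      2 * √s * ∑ i, heatAverage (partialDeriv i (partialDeriv i f)) s x := by
  simp_rw [fderiv_apply_eq_sum_partialDeriv]
  have hd : ∀ i z, HasFDerivAt (fun z => partialDeriv i f (x + √s • z))
      (√s • fderiv ℝ (partialDeriv i f) (x + √s • z)) z := by
    intro i z
    have h := ((hf i).differentiable (x + √s • z)).hasFDerivAt.comp z
      (((hasFDerivAt_id z).const_smul (√s)).const_add x)
    simpa [Function.comp_def] using h
  rw [integral_finsetSum, Finset.mul_sum]
  · refine Finset.sum_congr rfl fun i _ => ?_
    obtain ⟨C, hC⟩ := (hf i).bdd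
    obtain ⟨C', hC'⟩ := (hf i).bdd_fderiv
    rw [integral_mul_coord_heatMeasure (fun z => (hd i z).differentiableAt) (fun z => hC _)
      (C' := √s * C') (fun z => by
        rw [(hd i z).fderiv, norm_smul, Real.norm_of_nonneg (Real.sqrt_nonneg _)]
        exact mul_le_mul_of_nonneg_left (hC' _) (Real.sqrt_nonneg _))]
    simp_rw [fun z => (hd i z).fderiv]
    simp only [smul_apply, smul_eq_mul]
    rw [integral_const_mul, mul_assoc]
    rfl
  · intro i _
    obtain ⟨C, hC⟩ := (hf i).bdd
    refine (integrable_norm_heatMeasure.const_mul C).mono'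
      (((hf i).continuous.comp (by fun_prop)).mul (by fun_prop)).aestronglyMeasurable
      (Filter.Eventually.of_forall fun z => ?_)
    rw [norm_mul]
    exact mul_le_mul (hC _) (PiLp.norm_apply_le z i) (norm_nonneg _) ((abs_nonneg _).trans (hC z))

lemma exists_nhds_bound_inv_sqrt {t r : ℝ} (hr : r ∈ Set.Ioo 0 t) :
    ∃ K, 0 ≤ K ∧ ∃ s ∈ nhds r, ∀ ρ ∈ s, ρ ∈ Set.Ioo 0 t ∧ 1 / (2 * √(t - ρ)) ≤ K ∧
      1 / (2 * √ρ) ≤ K := by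
  have h1 : 0 < √(t - r) := Real.sqrt_pos.2 (by linarith [hr.2])
  have h2 : 0 < √r := Real.sqrt_pos.2 hr.1
  have c1 : ContinuousAt (fun ρ => 1 / (2 * √(t - ρ))) r :=
    continuousAt_const.div (by fun_prop) (by positivity)
  have c2 : ContinuousAt (fun ρ => 1 / (2 * √ρ)) r :=
    continuousAt_const.div (by fun_prop) (by positivity)
  have h3 : ∀ᶠ ρ in nhds r, ρ ∈ Set.Ioo 0 t := isOpen_Ioo.mem_nhds hr
  refine ⟨1 / (2 * √(t - r)) + 1 / (2 * √r) + 1, by positivity, _,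
    h3.and
    ((c1.eventually_lt_const (lt_add_one _)).and (c2.eventually_lt_const (lt_add_one _))),
    fun ρ hρ => ⟨hρ.1, hρ.2.1.le.trans ?_, hρ.2.2.le.trans ?_⟩⟩
  · have : 0 < 1 / (2 * √r) := by positivity
    linarith
  · have : 0 < 1 / (2 * √(t - r)) := by positivity
    linarith

/-- Heat flow equation, along the curve `ρ ↦ x + √(t - ρ) • z`. -/
lemma BoundedC1.hasDerivAt_heatAverage (hf : BoundedC1 f) (hf' : ∀ i, BoundedC1 (partialDeriv i f))
    {t r : ℝ} (hr : r ∈ Set.Ioo 0 t) (x z : EuclideanSpace ℝ (Fin n)) :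
    HasDerivAt (fun ρ => _root_.heatAverage f ρ (x + √(t - ρ) • z))
      (-(1 / (2 * √(t - r))) * fderiv ℝ (_root_.heatAverage f r) (x + √(t - r) • z) z +
        ∑ i, _root_.heatAverage (partialDeriv i (partialDeriv i f)) r (x + √(t - r) • z)) r := by
  obtain ⟨K, hK0, s, hs, hK⟩ := exists_nhds_bound_inv_sqrt hr
  obtain ⟨A, hA⟩ := hf.bdd
  obtain ⟨C, hC⟩ := hf.bdd_fderiv
  have hC0 : 0 ≤ C := (norm_nonneg _).trans (hC 0)
  have key := (hasDerivAt_integral_of_dominated_loc_of_deriv_le (μ := heatMeasure n)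
    (F := fun ρ z' => f (x + √(t - ρ) • z + √ρ • z'))
    (F' := fun ρ z' => fderiv ℝ f (x + √(t - ρ) • z + √ρ • z')
      (-(1 / (2 * √(t - ρ))) • z + (1 / (2 * √ρ)) • z'))
    (bound := fun z' => C * (K * ‖z‖ + K * ‖z'‖)) hs
    (Filter.Eventually.of_forall fun ρ =>
      (integrable_heatAverage hf.continuous hA ρ _).aestronglyMeasurable)
    (integrable_heatAverage hf.continuous hA r _)
    (((hf.continuous_fderiv.comp (by fun_prop)).clm_apply (by fun_prop)).aestronglyMeasurable)
    (Filter.Eventually.of_forall fun z' ρ hρ => ?_)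
    (((integrable_const _).add (integrable_norm_heatMeasure.const_mul K)).const_mul C)
    (Filter.Eventually.of_forall fun z' ρ hρ => ?_)).2
  · refine key.congr_deriv ?_
    have hz : Integrable (fun z' => fderiv ℝ f (x + √(t - r) • z + √r • z') z) (heatMeasure n) :=
      Integrable.of_bound ((hf.continuous_fderiv.comp
        (by fun_prop)).clm_apply continuous_const).aestronglyMeasurable (C * ‖z‖)
        (Filter.Eventually.of_forall fun z' => (fderiv ℝ f _).le_of_opNorm_le (hC _) z)
    have hz' : Integrable (fun z' => fderiv ℝ f (x + √(t - r) • z + √r • z') z')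
        (heatMeasure n) :=
      (integrable_norm_heatMeasure.const_mul C).mono' ((hf.continuous_fderiv.comp
        (by fun_prop)).clm_apply continuous_id).aestronglyMeasurable
        (Filter.Eventually.of_forall fun z' => (fderiv ℝ f _).le_of_opNorm_le (hC _) z')
    simp only [map_add, map_smul, smul_eq_mul]
    rw [integral_add (hz.const_mul _) (hz'.const_mul _), integral_const_mul, integral_const_mul,
      integral_fderiv_apply_self_heatMeasure hf', hf.fderiv_heatAverage,
      hf.heatAverage_fderiv_apply]
    have : 0 < √r := Real.sqrt_pos.2 hr.1
    field_simp
  · obtain ⟨hρ, h1, h2⟩ := hK ρ hρ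
    refine (fderiv ℝ f _).le_of_opNorm_le_of_le (hC _) ((norm_add_le _ _).trans ?_)
    rw [norm_smul, norm_smul, norm_neg, Real.norm_of_nonneg (by positivity),
      Real.norm_of_nonneg (by positivity)]
    gcongr
  · obtain ⟨hρ, -, -⟩ := hK ρ hρ
    have d1 : HasDerivAt (fun ρ => √(t - ρ)) (-(1 / (2 * √(t - ρ)))) ρ := by
      simpa [neg_div] using ((hasDerivAt_id ρ).const_sub t).sqrt (by simp; linarith [hρ.2])
    have d2 : HasDerivAt (fun ρ => √ρ) (1 / (2 * √ρ)) ρ := Real.hasDerivAt_sqrt hρ.1.ne'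
    exact (hf.differentiable _).hasFDerivAt.comp_hasDerivAt ρ
      (((d1.smul_const z).const_add x).add (d2.smul_const z'))

variable {ε : ℝ}

lemma contDiff_partialDeriv (hf : ContDiff ℝ (⊤ : ℕ∞) f) (i : Fin n) :
    ContDiff ℝ (⊤ : ℕ∞) (partialDeriv i f) :=
  (hf.fderiv_right (m := (⊤ : ℕ∞)) (by simp)).clm_apply contDiff_const

lemma hasFDerivAt_entropy (hf : BoundedC1 f) (hε : 0 < ε) (h : ∀ x, ε ≤ f x)
    (x : EuclideanSpace ℝ (Fin n)) :
    HasFDerivAt (fun y => f y * Real.log (f y)) ((Real.log (f x) + 1) • fderiv ℝ f x) x :=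
  (Real.hasDerivAt_mul_log (hε.trans_le (h x)).ne').comp_hasFDerivAt x
    (hf.differentiable x).hasFDerivAt

lemma BoundedC1.log_add_one (hf : BoundedC1 f) (hε : 0 < ε) (h : ∀ x, ε ≤ f x) :
    BoundedC1 fun x => Real.log (f x) + 1 := by
  simpa [add_comm] using (hf.log hε h).const_add 1

lemma partialDeriv_entropy (hf : BoundedC1 f) (hε : 0 < ε) (h : ∀ x, ε ≤ f x) (i : Fin n) :
    partialDeriv i (fun y => f y * Real.log (f y)) =
      fun x => (Real.log (f x) + 1) * partialDeriv i f x := by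
  ext x
  rw [partialDeriv, (hasFDerivAt_entropy hf hε h x).fderiv]
  rfl

lemma partialDeriv_partialDeriv_entropy (hf : BoundedC1 f) (hf' : ∀ i, BoundedC1 (partialDeriv i f))
    (hε : 0 < ε) (h : ∀ x, ε ≤ f x) (i : Fin n) (x : EuclideanSpace ℝ (Fin n)) :
    partialDeriv i (partialDeriv i fun y => f y * Real.log (f y)) x =
      partialDeriv i f x ^ 2 / f x +
        (Real.log (f x) + 1) * partialDeriv i (partialDeriv i f) x := by
  have hx := (hε.trans_le (h x)).ne'
  rw [partialDeriv_entropy hf hε h, partialDeriv,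
    fderiv_fun_mul ((hf.log_add_one hε h).differentiable x) ((hf' i).differentiable x),
    (((hf.differentiable x).hasFDerivAt.log hx).add_const 1).fderiv]
  simp only [add_apply, smul_apply, smul_eq_mul]
  simp only [partialDeriv]
  field_simp
  ring

lemma continuous_heatAverage_path {g : EuclideanSpace ℝ (Fin n) → F} (hg : Continuous g) {C : ℝ}
    (hC : ∀ x, ‖g x‖ ≤ C) (t : ℝ) (x : EuclideanSpace ℝ (Fin n)) :
    Continuous fun p : ℝ × EuclideanSpace ℝ (Fin n) =>
      heatAverage g p.1 (x + √(t - p.1) • p.2) :=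
  (continuous_heatAverage hg hC).comp
    (f := fun p : ℝ × EuclideanSpace ℝ (Fin n) => (p.1, x + √(t - p.1) • p.2)) (by fun_prop)

lemma continuous_heatAverage_sub {H : ℝ → EuclideanSpace ℝ (Fin n) → ℝ} {t : ℝ}
    {x : EuclideanSpace ℝ (Fin n)} (hH : Continuous fun p : ℝ × EuclideanSpace ℝ (Fin n) =>
      H p.1 (x + √(t - p.1) • p.2)) {C : ℝ} (hC : ∀ r y, |H r y| ≤ C) :
    Continuous fun r => heatAverage (H r) (t - r) x :=
  continuous_of_dominated
    (fun r => (hH.comp (Continuous.prodMk_right r)).aestronglyMeasurable)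
    (fun _ => Filter.Eventually.of_forall fun _ => hC _ _) (integrable_const C)
    (Filter.Eventually.of_forall fun z => hH.comp (Continuous.prodMk_left z))

lemma continuous_heatAverage_entropy (hf : BoundedC1 f) (hε : 0 < ε) (h : ∀ x, ε ≤ f x) (t : ℝ)
    (x : EuclideanSpace ℝ (Fin n)) :
    Continuous fun r =>
      heatAverage (fun y => heatAverage f r y * Real.log (heatAverage f r y)) (t - r) x := by
  obtain ⟨A, hA⟩ := hf.bdd
  have hA' := norm_heatAverage_le (g := f) hA
  refine continuous_heatAverage_sub
    (H := fun r y => heatAverage f r y * Real.log (heatAverage f r y))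
    (Real.continuous_mul_log.comp (continuous_heatAverage_path hf.continuous hA t x))
    (C := A * (|Real.log ε| + |Real.log A|)) fun r y => ?_
  rw [abs_mul]
  exact mul_le_mul (hA' _ _) (abs_log_le hε (le_heatAverage hf.continuous hA h _ _)
    ((le_abs_self _).trans (hA' _ _))) (abs_nonneg _) ((norm_nonneg _).trans (hA' 0 0))

lemma continuous_heatAverage_fisher (hf : BoundedC1 f) (hε : 0 < ε) (h : ∀ x, ε ≤ f x) (t : ℝ)
    (x : EuclideanSpace ℝ (Fin n)) :
    Continuous fun r => heatAverage (fun y =>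
      (∑ i, partialDeriv i (heatAverage f r) y ^ 2) / heatAverage f r y) (t - r) x := by
  obtain ⟨A, hA⟩ := hf.bdd
  obtain ⟨C, hC⟩ := hf.bdd_fderiv
  simp_rw [hf.partialDeriv_heatAverage]
  have hw : ∀ r y, ε ≤ heatAverage f r y := le_heatAverage hf.continuous hA h
  have hb : ∀ i r y, |heatAverage (partialDeriv i f) r y| ≤ C := fun i =>
    norm_heatAverage_le (g := partialDeriv i f) (abs_partialDeriv_le hC i)
  refine continuous_heatAverage_sub
    (H := fun r y => (∑ i, heatAverage (partialDeriv i f) r y ^ 2) / heatAverage f r y)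
    ((continuous_finsetSum _ fun i _ => (continuous_heatAverage_path (hf.continuous_partialDeriv i)
      (abs_partialDeriv_le hC i) t x).pow 2).div
      (continuous_heatAverage_path hf.continuous hA t x) fun p => (hε.trans_le (hw _ _)).ne')
    (C := (∑ _i : Fin n, C ^ 2) / ε) fun r y => ?_
  rw [abs_of_nonneg (div_nonneg (Finset.sum_nonneg fun i _ => sq_nonneg _) (hε.le.trans (hw r y)))]
  exact div_le_div₀ (Finset.sum_nonneg fun i _ => sq_nonneg C)
    (Finset.sum_le_sum fun i _ => sq_le_sq' (abs_le.1 (hb i r y)).1 (abs_le.1 (hb i r y)).2) hε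
    (hw r y)

/-- The space and time contributions to the derivative of the entropy at scale `√s` combine, after
integration by parts, to minus the average of the Fisher information density. -/
lemma integral_log_mul_heatMeasure (hf : BoundedC1 f) (hf' : ∀ i, BoundedC1 (partialDeriv i f))
    (hf'' : ∀ i, BoundedC1 (partialDeriv i (partialDeriv i f))) (hε : 0 < ε) (h : ∀ x, ε ≤ f x)
    {s : ℝ} (hs : 0 < s) (x : EuclideanSpace ℝ (Fin n)) :
    ∫ z, (Real.log (f (x + √s • z)) + 1) * (-(1 / (2 * √s)) * fderiv ℝ f (x + √s • z) z +
        ∑ i, partialDeriv i (partialDeriv i f) (x + √s • z)) ∂heatMeasure n =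
      -heatAverage (fun y => (∑ i, partialDeriv i f y ^ 2) / f y) s x := by
  have hpos : 0 < √s := Real.sqrt_pos.2 hs
  have hent : ∀ i, BoundedC1 (partialDeriv i fun y => f y * Real.log (f y)) := fun i => by
    rw [partialDeriv_entropy hf hε h]
    exact (hf.log_add_one hε h).mul (hf' i)
  have hint : ∀ i, Integrable (fun z =>
      partialDeriv i (partialDeriv i fun y => f y * Real.log (f y)) (x + √s • z))
      (heatMeasure n) := fun i => by
    obtain ⟨D, hD⟩ := (hent i).bdd_fderiv
    exact integrable_heatAverage ((hent i).continuous_partialDeriv i)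
      (abs_partialDeriv_le hD i) s x
  have hint' : ∀ i, Integrable (fun z => (Real.log (f (x + √s • z)) + 1) *
      partialDeriv i (partialDeriv i f) (x + √s • z)) (heatMeasure n) := fun i => by
    have hb := (hf.log_add_one hε h).mul (hf'' i)
    obtain ⟨D, hD⟩ := hb.bdd
    exact integrable_heatAverage hb.continuous hD s x
  have hrad : Integrable (fun z =>
      fderiv ℝ (fun y => f y * Real.log (f y)) (x + √s • z) z) (heatMeasure n) := by
    have hb := hf.mul (hf.log hε h)
    obtain ⟨D, hD⟩ := hb.bdd_fderiv
    exact (integrable_norm_heatMeasure.const_mul D).mono' ((hb.continuous_fderiv.comp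
      (by fun_prop)).clm_apply continuous_id).aestronglyMeasurable
      (Filter.Eventually.of_forall fun z => (fderiv ℝ _ _).le_of_opNorm_le (hD _) z)
  have hsplit : ∀ z, (Real.log (f (x + √s • z)) + 1) *
      (-(1 / (2 * √s)) * fderiv ℝ f (x + √s • z) z +
        ∑ i, partialDeriv i (partialDeriv i f) (x + √s • z)) =
      -(1 / (2 * √s)) * fderiv ℝ (fun y => f y * Real.log (f y)) (x + √s • z) z +
        ∑ i, (Real.log (f (x + √s • z)) + 1) *
          partialDeriv i (partialDeriv i f) (x + √s • z) := by
    intro z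
    rw [(hasFDerivAt_entropy hf hε h _).fderiv, ← Finset.mul_sum]
    simp only [smul_apply, smul_eq_mul]
    ring
  simp_rw [hsplit]
  rw [integral_add (hrad.const_mul _) (integrable_finsetSum _ fun i _ => hint' i),
    integral_const_mul, integral_fderiv_apply_self_heatMeasure hent, ← mul_assoc,
    show -(1 / (2 * √s)) * (2 * √s) = -1 by field_simp]
  simp only [heatAverage]
  rw [← integral_finsetSum _ fun i _ => hint i, neg_one_mul, neg_add_eq_sub,
    ← integral_sub (integrable_finsetSum _ fun i _ => hint' i)
      (integrable_finsetSum _ fun i _ => hint i), ← integral_neg]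
  congr 1
  ext z
  rw [← Finset.sum_sub_distrib, Finset.sum_div, ← Finset.sum_neg_distrib]
  refine Finset.sum_congr rfl fun i _ => ?_
  rw [partialDeriv_partialDeriv_entropy hf hf' hε h]
  ring

lemma hasDerivAt_heatAverage_entropy (hf : BoundedC1 f) (hf' : ∀ i, BoundedC1 (partialDeriv i f))
    (hf'' : ∀ i, BoundedC1 (partialDeriv i (partialDeriv i f))) (hε : 0 < ε) (h : ∀ x, ε ≤ f x)
    {t r : ℝ} (hr : r ∈ Set.Ioo 0 t) (x : EuclideanSpace ℝ (Fin n)) :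
    HasDerivAt (fun r =>
      heatAverage (fun y => heatAverage f r y * Real.log (heatAverage f r y)) (t - r) x)
      (-heatAverage (fun y =>
        (∑ i, partialDeriv i (heatAverage f r) y ^ 2) / heatAverage f r y) (t - r) x) r := by
  obtain ⟨K, hK0, s, hs, hK⟩ := exists_nhds_bound_inv_sqrt hr
  obtain ⟨A, hA⟩ := hf.bdd
  obtain ⟨C, hC⟩ := hf.bdd_fderiv
  choose B hB using fun i => (hf'' i).bdd
  have hC0 : 0 ≤ C := (norm_nonneg _).trans (hC 0)
  have hA' := norm_heatAverage_le (g := f) hA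
  have hw : ∀ r y, ε ≤ heatAverage f r y := le_heatAverage hf.continuous hA h
  have hwr := hf.heatAverage r
  have hwr' : ∀ i, BoundedC1 (partialDeriv i (heatAverage f r)) := fun i => by
    rw [hf.partialDeriv_heatAverage]; exact (hf' i).heatAverage r
  have hpp : ∀ i, heatAverage (partialDeriv i (partialDeriv i f)) r =
      partialDeriv i (partialDeriv i (heatAverage f r)) := fun i => by
    rw [hf.partialDeriv_heatAverage, (hf' i).partialDeriv_heatAverage]
  have hc := Real.continuous_mul_log.comp (continuous_heatAverage_path hf.continuous hA t x)
  have hlog := hwr.log_add_one hε (hw r)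
  have hcp : Continuous fun z : EuclideanSpace ℝ (Fin n) => x + √(t - r) • z := by fun_prop
  have hcsum : Continuous fun y =>
      ∑ i, heatAverage (partialDeriv i (partialDeriv i f)) r y :=
    continuous_finsetSum _ fun i _ => ((hf'' i).heatAverage r).continuous
  have hBsum : ∀ ρ y, |∑ i, heatAverage (partialDeriv i (partialDeriv i f)) ρ y| ≤ ∑ i, B i :=
    fun ρ y => (Finset.abs_sum_le_sum_abs _ _).trans (Finset.sum_le_sum fun i _ =>
      norm_heatAverage_le (g := partialDeriv i (partialDeriv i f)) (hB i) ρ y)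
  have hlogb : ∀ ρ y, |Real.log (heatAverage f ρ y) + 1| ≤ |Real.log ε| + |Real.log A| + 1 :=
    fun ρ y => (abs_add_le _ _).trans (by
      rw [abs_one]
      gcongr
      exact abs_log_le hε (hw _ _) ((le_abs_self _).trans (hA' _ _)))
  have key := (hasDerivAt_integral_of_dominated_loc_of_deriv_le (μ := heatMeasure n)
    (F := fun ρ z => heatAverage f ρ (x + √(t - ρ) • z) *
      Real.log (heatAverage f ρ (x + √(t - ρ) • z)))
    (F' := fun ρ z => (Real.log (heatAverage f ρ (x + √(t - ρ) • z)) + 1) *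
      (-(1 / (2 * √(t - ρ))) * fderiv ℝ (heatAverage f ρ) (x + √(t - ρ) • z) z +
        ∑ i, heatAverage (partialDeriv i (partialDeriv i f)) ρ (x + √(t - ρ) • z)))
    (bound := fun z => (|Real.log ε| + |Real.log A| + 1) * (K * (C * ‖z‖) + ∑ i, B i)) hs
    (Filter.Eventually.of_forall fun ρ => (hc.comp (Continuous.prodMk_right ρ)).aestronglyMeasurable)
    ?_ ?_ (Filter.Eventually.of_forall fun z ρ hρ => ?_)
    ((((integrable_norm_heatMeasure.const_mul C).const_mul K).add (integrable_const _)).const_mul _)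
    (Filter.Eventually.of_forall fun z ρ hρ => ?_)).2
  · refine key.congr_deriv ?_
    simp_rw [hpp]
    exact integral_log_mul_heatMeasure hwr hwr' (fun i => hpp i ▸ (hf'' i).heatAverage r) hε (hw r)
      (by linarith [hr.2]) x
  · obtain ⟨D, hD⟩ := (hwr.mul (hwr.log hε (hw r))).bdd
    exact integrable_heatAverage (hwr.mul (hwr.log hε (hw r))).continuous hD _ _
  · exact ((hlog.continuous.comp hcp).mul ((continuous_const.mul
      ((hwr.continuous_fderiv.comp hcp).clm_apply continuous_id)).add
      (hcsum.comp hcp))).aestronglyMeasurable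
  · obtain ⟨hρ, h1, -⟩ := hK ρ hρ
    rw [norm_mul]
    refine mul_le_mul (hlogb _ _) ((norm_add_le _ _).trans (add_le_add ?_ (hBsum _ _)))
      (norm_nonneg _) (by positivity)
    rw [norm_mul, norm_neg, Real.norm_of_nonneg (by positivity)]
    refine mul_le_mul h1 ((fderiv ℝ _ _).le_of_opNorm_le ?_ z) (norm_nonneg _) hK0
    rw [hf.fderiv_heatAverage]
    exact norm_heatAverage_le hC _ _
  · exact (Real.hasDerivAt_mul_log (hε.trans_le (hw _ _)).ne').comp ρ
      (hf.hasDerivAt_heatAverage hf' (hK ρ hρ).1 x z)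

end HeatAverage

/-- Entropy interpolation along the heat semigroup (flat-space case of the heat kernel
homotopy principle, Lemma 3.1 of Hein–Naber, with `φ(x) = x·log x`), for the positive
function `u = ε + v` with `v` smooth, nonnegative and compactly supported. -/
theorem entropy_interpolation_heatSemigroup (n : ℕ) (hn : 1 ≤ n) (ε : ℝ) (hε : 0 < ε)
    (v : EuclideanSpace ℝ (Fin n) → ℝ) (hv : ContDiff ℝ (⊤ : ℕ∞) v) (hv0 : ∀ y, 0 ≤ v y)
    (hsupp : HasCompactSupport v) (u : EuclideanSpace ℝ (Fin n) → ℝ)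
    (hu : u = fun y => ε + v y) (t : ℝ) (ht : 0 < t)
    (x₀ : EuclideanSpace ℝ (Fin n)) :
    heatSemigroup n t (fun y => u y * Real.log (u y)) x₀ -
      heatSemigroup n t u x₀ * Real.log (heatSemigroup n t u x₀) =
      ∫ r in (0:ℝ)..t, heatSemigroup n (t - r)
        (fun y => ‖gradient (heatSemigroup n r u) y‖ ^ 2 / heatSemigroup n r u y) x₀ := by
  have hu1 : BoundedC1 u := by
    rw [hu]
    exact (BoundedC1.of_hasCompactSupport (hv.of_le (by simp)) hsupp).const_add ε
  have hpd : ∀ i, partialDeriv i u = partialDeriv i v := by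
    intro i
    ext x
    simp [partialDeriv, hu]
  have hu2 : ∀ i, BoundedC1 (partialDeriv i u) := fun i => by
    rw [hpd]
    exact .of_hasCompactSupport ((contDiff_partialDeriv hv i).of_le (by simp))
      (hsupp.fderiv_apply ℝ _)
  have hu3 : ∀ i, BoundedC1 (partialDeriv i (partialDeriv i u)) := fun i => by
    rw [hpd]
    exact .of_hasCompactSupport
      ((contDiff_partialDeriv (contDiff_partialDeriv hv i) i).of_le (by simp))
      ((hsupp.fderiv_apply ℝ _).fderiv_apply ℝ _)
  have hεu : ∀ y, ε ≤ u y := fun y => by simp [hu, hv0 y]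
  have hF := continuous_heatAverage_entropy hu1 hε hεu t x₀
  have hG := continuous_heatAverage_fisher hu1 hε hεu t x₀
  have key := intervalIntegral.integral_eq_sub_of_hasDerivAt_of_le ht.le hF.continuousOn
    (fun r hr => hasDerivAt_heatAverage_entropy hu1 hu2 hu3 hε hεu hr x₀)
    (hG.neg.intervalIntegrable 0 t)
  simp only [intervalIntegral.integral_neg, sub_self, sub_zero, heatAverage_zero] at key
  rw [heatSemigroup_eq_heatAverage ht.le, heatSemigroup_eq_heatAverage ht.le,
    ← neg_sub, ← key, neg_neg]
  refine intervalIntegral.integral_congr fun r hr => ?_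
  rw [Set.uIcc_of_le ht.le] at hr
  simp only [heatSemigroup_eq_heatAverage hr.1, heatSemigroup_eq_heatAverage (sub_nonneg.2 hr.2),
    norm_gradient_sq_eq_sum]
end

section
/- (Logarithmic gradient estimate along the heat semigroup.) Let n ≥ 1, let ε > 0 and let v : ℝⁿ → ℝ be smooth, nonnegative and compactly supported, and set u = ε + v. Then for every t > 0 and every x ∈ ℝⁿ: ‖∇(P_t u)(x)‖² ≤ (P_t u)(x) · P_t( ‖∇u‖²/u )(x); equivalently, ‖∇(P_t u)‖²/(P_t u) ≤ P_t(‖∇u‖²/u) pointwise. -/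
open MeasureTheory Real

/-- The weighted Cauchy–Schwarz inequality `(∫ g K)² ≤ (∫ a K) (∫ (g² / a) K)` for `a` positive
and `K` nonnegative. -/
theorem sq_integral_mul_le_integral_mul_integral_sq_div {α : Type*} [MeasurableSpace α]
    {μ : Measure α} {a g K : α → ℝ} (ha : ∀ y, 0 < a y) (hK : ∀ y, 0 ≤ K y)
    (haK : Integrable (fun y => a y * K y) μ) (hgK : Integrable (fun y => g y * K y) μ)
    (hbK : Integrable (fun y => g y ^ 2 / a y * K y) μ) :
    (∫ y, g y * K y ∂μ) ^ 2 ≤ (∫ y, a y * K y ∂μ) * ∫ y, g y ^ 2 / a y * K y ∂μ := by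
  have key : discrim (∫ y, a y * K y ∂μ) (-2 * ∫ y, g y * K y ∂μ)
      (∫ y, g y ^ 2 / a y * K y ∂μ) ≤ 0 := by
    refine discrim_le_zero fun l => ?_
    have hexpand : (∫ y, a y * K y ∂μ) * (l * l) + (-2 * ∫ y, g y * K y ∂μ) * l
        + ∫ y, g y ^ 2 / a y * K y ∂μ
        = ∫ y, (l * l * (a y * K y) + (-2 * l) * (g y * K y) + g y ^ 2 / a y * K y) ∂μ := by
      have hlin : Integrable
          (fun y => l * l * (a y * K y) + (-2 * l) * (g y * K y)) μ :=
        (haK.const_mul _).add (hgK.const_mul _)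
      rw [integral_add hlin hbK,
        integral_add (haK.const_mul _) (hgK.const_mul _), integral_const_mul, integral_const_mul]
      ring
    rw [hexpand]
    refine integral_nonneg fun y => ?_
    have hay := (ha y).ne'
    have hsq : l * l * (a y * K y) + (-2 * l) * (g y * K y) + g y ^ 2 / a y * K y
        = (l * a y - g y) ^ 2 / a y * K y := by
      field_simp
      ring
    simp only [hsq, Pi.zero_apply]
    exact mul_nonneg (div_nonneg (sq_nonneg _) (ha y).le) (hK y)
  rw [discrim] at key
  nlinarith [key]

/-- Differentiation under the integral sign for the average of the translates of `u`
against an integrable weight. -/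
theorem hasFDerivAt_integral_sub_mul {E : Type*} [NormedAddCommGroup E] [NormedSpace ℝ E]
    [MeasurableSpace E] [BorelSpace E] [SecondCountableTopology E] {μ : Measure E}
    {u K : E → ℝ} {C D : ℝ} (hu : ContDiff ℝ 1 u) (hC : ∀ y, ‖u y‖ ≤ C)
    (hD : ∀ y, ‖fderiv ℝ u y‖ ≤ D) (hK : Integrable K μ) (x : E) :
    HasFDerivAt (fun x' => ∫ z, u (x' - z) * K z ∂μ)
      (∫ z, K z • fderiv ℝ u (x - z) ∂μ) x := by
  have hint (x' : E) : Integrable (fun z => u (x' - z) * K z) μ :=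
    hK.bdd_mul (hu.continuous.comp (continuous_const.sub continuous_id)).aestronglyMeasurable
      (.of_forall fun z => hC _)
  refine hasFDerivAt_integral_of_dominated_of_fderiv_le (s := Set.univ)
    (bound := fun z => D * ‖K z‖) (F' := fun x' z => K z • fderiv ℝ u (x' - z)) Filter.univ_mem
    (.of_forall fun x' => (hint x').aestronglyMeasurable) (hint x) ?_ ?_
    (hK.norm.const_mul D) ?_
  · exact hK.aestronglyMeasurable.smul ((hu.continuous_fderiv one_ne_zero).comp
      (continuous_const.sub continuous_id)).aestronglyMeasurable
  · refine .of_forall fun z x' _ => ?_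
    rw [norm_smul, mul_comm]
    exact mul_le_mul_of_nonneg_right (hD _) (norm_nonneg _)
  · refine .of_forall fun z x' _ => ?_
    have hd : HasFDerivAt (fun x' => u (x' - z)) (fderiv ℝ u (x' - z)) x' := by
      have h := ((hu.differentiable one_ne_zero) (x' - z)).hasFDerivAt.comp x'
        ((hasFDerivAt_id x').sub_const z)
      simpa [Function.comp_def] using h
    exact hd.mul_const (K z)

/-- The Gaussian weight defining the heat semigroup is integrable. -/
theorem integrable_const_mul_exp_neg_norm_sq_div {V : Type*} [NormedAddCommGroup V]
    [InnerProductSpace ℝ V] [FiniteDimensional ℝ V] [MeasurableSpace V] [BorelSpace V]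
    (c : ℝ) {t : ℝ} (ht : 0 < t) :
    Integrable fun z : V => c * Real.exp (-‖z‖ ^ 2 / (4 * t)) := by
  refine Integrable.const_mul ?_ c
  have hb : 0 < (((4 * t)⁻¹ : ℝ) : ℂ).re := by
    rw [Complex.ofReal_re]
    positivity
  refine (GaussianFourier.integrable_cexp_neg_mul_sq_norm_add hb 0 (0 : V)).norm.congr
    (.of_forall fun z => ?_)
  simp only [Complex.norm_exp]
  congr 1
  rw [zero_mul, add_zero, ← Complex.ofReal_pow, ← Complex.ofReal_neg, ← Complex.ofReal_mul,
    Complex.ofReal_re]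
  ring

/-- The heat semigroup as an average of translates against the Gaussian weight. -/
theorem heatSemigroup_eq_integral_sub {n : ℕ} {t : ℝ} (ht : t ≠ 0)
    (f : EuclideanSpace ℝ (Fin n) → ℝ) (x : EuclideanSpace ℝ (Fin n)) :
    heatSemigroup n t f x = ∫ z, f (x - z) *
      ((4 * π * t) ^ (-(n : ℝ) / 2) * Real.exp (-‖z‖ ^ 2 / (4 * t))) := by
  rw [heatSemigroup, if_neg ht, ← integral_sub_left_eq_self _ volume x]
  simp only [sub_sub_cancel]

/-- The gradient and the Fréchet derivative have the same norm. -/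
theorem norm_gradient {F : Type*} [NormedAddCommGroup F] [InnerProductSpace ℝ F] [CompleteSpace F]
    (f : F → ℝ) (x : F) : ‖gradient f x‖ = ‖fderiv ℝ f x‖ := by
  rw [gradient, LinearIsometryEquiv.norm_map]

/-- Logarithmic gradient estimate along the heat semigroup: the flat-space case of
identity (3.11) of Hein–Naber after dropping the nonnegative Hessian remainder:
`‖∇(P_t u)‖²/(P_t u) ≤ P_t(‖∇u‖²/u)` pointwise, for `u = ε + v` with `v` smooth,
nonnegative and compactly supported. -/
theorem log_gradient_estimate_heatSemigroup (n : ℕ) (hn : 1 ≤ n) (ε : ℝ) (hε : 0 < ε)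
    (v : EuclideanSpace ℝ (Fin n) → ℝ) (hv : ContDiff ℝ (⊤ : ℕ∞) v) (hv0 : ∀ y, 0 ≤ v y)
    (hsupp : HasCompactSupport v) (u : EuclideanSpace ℝ (Fin n) → ℝ)
    (hu : u = fun y => ε + v y) (t : ℝ) (ht : 0 < t) (x : EuclideanSpace ℝ (Fin n)) :
    ‖gradient (heatSemigroup n t u) x‖ ^ 2 ≤
      heatSemigroup n t u x *
        heatSemigroup n t (fun y => ‖gradient u y‖ ^ 2 / u y) x := by
  set K : EuclideanSpace ℝ (Fin n) → ℝ := fun z =>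
    (4 * π * t) ^ (-(n : ℝ) / 2) * Real.exp (-‖z‖ ^ 2 / (4 * t))
  have hK : Integrable K := integrable_const_mul_exp_neg_norm_sq_div _ ht
  have hK0 (z) : 0 ≤ K z := by positivity
  have huε (y) : ε ≤ u y := by simp [hu, hv0 y]
  have hu0 (y) : 0 < u y := hε.trans_le (huε y)
  have hv1 : ContDiff ℝ 1 v := hv.of_le (by exact_mod_cast le_top)
  have hu1 : ContDiff ℝ 1 u := hu ▸ contDiff_const.add hv1
  have hfd : fderiv ℝ u = fderiv ℝ v := by
    ext1 y
    rw [hu, fderiv_const_add]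
  obtain ⟨C, hC⟩ := hsupp.exists_bound_of_continuous hv1.continuous
  obtain ⟨D, hD⟩ := (hsupp.fderiv ℝ).exists_bound_of_continuous
    (hv1.continuous_fderiv one_ne_zero)
  rw [← hfd] at hD
  have hC' (y) : ‖u y‖ ≤ ε + C := by
    rw [hu]
    refine (norm_add_le _ _).trans ?_
    rw [Real.norm_of_nonneg hε.le]
    linarith [hC y]
  have hdc : Continuous (fderiv ℝ u) := hu1.continuous_fderiv one_ne_zero
  have hsub : Continuous fun z => x - z := continuous_const.sub continuous_id
  have huK : Integrable fun z => u (x - z) * K z :=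
    hK.bdd_mul (hu1.continuous.comp hsub).aestronglyMeasurable (.of_forall fun z => hC' _)
  have hgK : Integrable fun z => ‖fderiv ℝ u (x - z)‖ * K z :=
    hK.bdd_mul (hdc.norm.comp hsub).aestronglyMeasurable
      (.of_forall fun z => by rw [norm_norm]; exact hD _)
  have hbK : Integrable fun z => ‖fderiv ℝ u (x - z)‖ ^ 2 / u (x - z) * K z := by
    refine hK.bdd_mul (c := D ^ 2 / ε)
      (((hdc.norm.pow 2).div hu1.continuous fun y => (hu0 y).ne').comp hsub).aestronglyMeasurable
      (.of_forall fun z => ?_)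
    rw [Real.norm_of_nonneg (div_nonneg (sq_nonneg _) (hu0 _).le)]
    exact div_le_div₀ (sq_nonneg _) (pow_le_pow_left₀ (norm_nonneg _) (hD _) 2) hε (huε _)
  have hderiv : fderiv ℝ (heatSemigroup n t u) x = ∫ z, K z • fderiv ℝ u (x - z) := by
    rw [funext (heatSemigroup_eq_integral_sub ht.ne' u)]
    exact (hasFDerivAt_integral_sub_mul hu1 hC' hD hK x).fderiv
  have hle : ‖fderiv ℝ (heatSemigroup n t u) x‖ ≤ ∫ z, ‖fderiv ℝ u (x - z)‖ * K z := by
    rw [hderiv]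
    refine (norm_integral_le_integral_norm _).trans_eq (integral_congr_ae (.of_forall fun z => ?_))
    simp only [norm_smul, Real.norm_of_nonneg (hK0 z), mul_comm]
  simp only [norm_gradient, heatSemigroup_eq_integral_sub ht.ne' u x,
    heatSemigroup_eq_integral_sub ht.ne' (fun y => ‖fderiv ℝ u y‖ ^ 2 / u y) x]
  exact (pow_le_pow_left₀ (norm_nonneg _) hle 2).trans
    (sq_integral_mul_le_integral_mul_integral_sq_div (fun z => hu0 _) hK0 huK hgK hbK)
end

section
/- (Equivalence of the two forms of the log-Sobolev inequality.) Let ν be a Borel probability measure on ℝⁿ (EuclideanSpace ℝ (Fin n)) and let c > 0. Assume that for every ε > 0 and every smooth, nonnegative, compactly supported v : ℝⁿ → ℝ, the function u = ε + v satisfies ∫ u·log u dν - (∫ u dν)·log(∫ u dν) ≤ c·∫ ‖∇u‖²/u dν. Then every smooth compactly supported φ : ℝⁿ → ℝ with ∫ φ² dν = 1 satisfies ∫ φ²·log(φ²) dν ≤ 4c·∫ ‖∇φ‖² dν. -/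
open MeasureTheory Real

/-- The pointwise bound `‖∇(φ²)‖² / (ε + φ²) ≤ 4 ‖∇φ‖²`. -/
lemma norm_gradient_const_add_sq_div_le {E : Type*} [NormedAddCommGroup E]
    [InnerProductSpace ℝ E] [CompleteSpace E] {φ : E → ℝ} {x : E}
    (hφ : DifferentiableAt ℝ φ x) {ε : ℝ} (hε : 0 < ε) :
    ‖gradient (fun z => ε + φ z ^ 2) x‖ ^ 2 / (ε + φ x ^ 2) ≤ 4 * ‖gradient φ x‖ ^ 2 := by
  have hderiv : fderiv ℝ (fun z => ε + φ z ^ 2) x = (2 * φ x) • fderiv ℝ φ x := by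
    simpa using ((hφ.hasFDerivAt.pow 2).const_add ε).fderiv
  simp only [gradient, LinearIsometryEquiv.norm_map, hderiv, norm_smul, Real.norm_eq_abs]
  rw [div_le_iff₀ (by positivity), mul_pow, sq_abs]
  nlinarith [mul_nonneg hε.le (sq_nonneg ‖fderiv ℝ φ x‖)]

/-- Integrals of `g (ε + v)` converge to the integral of `g v` as `ε → 0⁺`, for `g` continuous
and `v` continuous with compact support. -/
lemma tendsto_integral_comp_const_add {X : Type*} [TopologicalSpace X] [MeasurableSpace X]
    [OpensMeasurableSpace X] (μ : Measure X) [IsFiniteMeasure μ] {g : ℝ → ℝ} (hg : Continuous g)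
    {v : X → ℝ} (hv : Continuous v) (hsupp : HasCompactSupport v) :
    Filter.Tendsto (fun ε : ℝ => ∫ x, g (ε + v x) ∂μ) (nhdsWithin 0 (Set.Ioi 0))
      (nhds (∫ x, g (v x) ∂μ)) := by
  obtain ⟨M, hM⟩ := hv.bounded_above_of_compact_support hsupp
  obtain ⟨B, hB⟩ := (isCompact_Icc (a := -M) (b := 1 + M)).exists_bound_of_continuousOn
    hg.continuousOn
  refine tendsto_integral_filter_of_dominated_convergence (fun _ => B) ?_ ?_
    (integrable_const B) ?_
  · exact .of_forall fun ε =>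
      (hg.comp (continuous_const.add hv)).measurable.aestronglyMeasurable
  · filter_upwards [Ioc_mem_nhdsGT (zero_lt_one (α := ℝ))] with ε hε
    refine .of_forall fun x => hB _ ?_
    have hx := abs_le.mp (hM x)
    exact ⟨by linarith [hε.1, hx.1], by linarith [hε.2, hx.2]⟩
  · refine .of_forall fun x => Filter.Tendsto.mono_left ?_ nhdsWithin_le_nhds
    have hcont : Continuous fun ε : ℝ => g (ε + v x) := by fun_prop
    simpa using hcont.tendsto 0

/-- Equivalence of the two forms of the log-Sobolev inequality (reduction (3.1)–(3.3)
of Hein–Naber): the entropy form, stated for the positive functions `u = ε + v` with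
`v` smooth, nonnegative and compactly supported, implies the standard form for smooth
compactly supported `φ` with `∫ φ² dν = 1`. -/
theorem logSobolev_standard_of_entropy_form (n : ℕ)
    (ν : Measure (EuclideanSpace ℝ (Fin n))) [IsProbabilityMeasure ν]
    (c : ℝ) (hc : 0 < c)
    (hent : ∀ ε : ℝ, 0 < ε → ∀ v : EuclideanSpace ℝ (Fin n) → ℝ,
      ContDiff ℝ (⊤ : ℕ∞) v → (∀ y, 0 ≤ v y) → HasCompactSupport v →
      ∫ y, (ε + v y) * Real.log (ε + v y) ∂ν -
        (∫ y, (ε + v y) ∂ν) * Real.log (∫ y, (ε + v y) ∂ν) ≤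
        c * ∫ y, ‖gradient (fun z => ε + v z) y‖ ^ 2 / (ε + v y) ∂ν)
    (φ : EuclideanSpace ℝ (Fin n) → ℝ) (hφ : ContDiff ℝ (⊤ : ℕ∞) φ)
    (hsupp : HasCompactSupport φ) (hnorm : ∫ y, (φ y) ^ 2 ∂ν = 1) :
    ∫ y, (φ y) ^ 2 * Real.log ((φ y) ^ 2) ∂ν ≤ 4 * c * ∫ y, ‖gradient φ y‖ ^ 2 ∂ν := by
  have hsq : HasCompactSupport fun y => φ y ^ 2 :=
    hsupp.comp_left (g := fun t : ℝ => t ^ 2) (by simp)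
  have hsq_int : Integrable (fun y => φ y ^ 2) ν :=
    (hφ.continuous.pow 2).integrable_of_hasCompactSupport hsq
  have hgrad_int : Integrable (fun y => 4 * ‖gradient φ y‖ ^ 2) ν := by
    have hcont : Continuous fun y => ‖fderiv ℝ φ y‖ ^ 2 :=
      (hφ.continuous_fderiv (by simp)).norm.pow 2
    have hcompact : HasCompactSupport fun y => ‖fderiv ℝ φ y‖ ^ 2 :=
      (hsupp.fderiv (𝕜 := ℝ)).norm.comp_left (g := fun t : ℝ => t ^ 2) (by simp)
    simp only [gradient, LinearIsometryEquiv.norm_map]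
    exact (hcont.integrable_of_hasCompactSupport hcompact).const_mul 4
  have hbound : ∀ ε : ℝ, 0 < ε →
      ∫ y, (ε + φ y ^ 2) * Real.log (ε + φ y ^ 2) ∂ν - (ε + 1) * Real.log (ε + 1) ≤
        4 * c * ∫ y, ‖gradient φ y‖ ^ 2 ∂ν := by
    intro ε hε
    have hmass : ∫ y, (ε + φ y ^ 2) ∂ν = ε + 1 := by
      rw [integral_add (integrable_const ε) hsq_int, hnorm]
      simp
    have h := hent ε hε (fun y => φ y ^ 2) (hφ.pow 2) (fun y => sq_nonneg _) hsq
    rw [hmass] at h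
    refine h.trans ?_
    rw [mul_comm 4 c, mul_assoc, ← integral_const_mul 4]
    refine mul_le_mul_of_nonneg_left (integral_mono_of_nonneg ?_ hgrad_int ?_) hc.le
    · exact .of_forall fun y => by positivity
    · exact .of_forall fun y => norm_gradient_const_add_sq_div_le
        (hφ.differentiable (by simp) y) hε
  have hlim := tendsto_integral_comp_const_add ν Real.continuous_mul_log (hφ.continuous.pow 2) hsq
  have hlog : Filter.Tendsto (fun ε : ℝ => (ε + 1) * Real.log (ε + 1))
      (nhdsWithin 0 (Set.Ioi 0)) (nhds 0) := by
    have hcont : Continuous fun ε : ℝ => (ε + 1) * Real.log (ε + 1) :=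
      Real.continuous_mul_log.comp (continuous_id.add continuous_const)
    simpa using (hcont.tendsto 0).mono_left nhdsWithin_le_nhds
  have h := le_of_tendsto (hlim.sub hlog)
    (Filter.eventually_of_mem self_mem_nhdsWithin fun ε hε => hbound ε hε)
  simpa only [sub_zero, Pi.pow_apply] using h
end
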